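/- Let G be a connected graph with distinct real edge weights, containing an edge pq, and let G⁺ be obtained from G by adding a new vertex r adjacent to p and q, with weights on pr and qr distinct from each other and from all weights of G. Among the three edges pq, pr, qr, let the bottleneck edge be the maximum-weight edge on the minimum spanning tree path from p to q in the triangle pqr, and reweight edge pq in G by the bottleneck weight. Then the multiset of edge weights of the minimum spanning tree of G⁺ equals the multiset of edge weights of the minimum spanning tree of the reweighted G, together with the minimum weight among the two non-bottleneck edges of the triangle pqr. -/

import Mathlib

/-- `H` is a minimum spanning tree of `G` with respect to edge weights `w`:
a spanning subgraph that is a tree, of minimum total weight among all such. -/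
def IsMST {V : Type} (G : SimpleGraph V) (w : Sym2 V → ℝ) (H : G.Subgraph) : Prop :=
  H.IsSpanning ∧ H.coe.IsTree ∧
    ∀ H' : G.Subgraph, H'.IsSpanning → H'.coe.IsTree →
      ∑ᶠ e ∈ H.edgeSet, w e ≤ ∑ᶠ e ∈ H'.edgeSet, w e

/-- The graph `G⁺` obtained from `G` by adding a new vertex `r` adjacent to `p` and `q`. -/
def addApex {V : Type} (G : SimpleGraph V) (p q : V) : SimpleGraph (V ⊕ Unit) :=
  SimpleGraph.fromRel (fun x y =>
    match x, y with
    | Sum.inl u, Sum.inl v => G.Adj u v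
    | Sum.inl u, Sum.inr _ => u = p ∨ u = q
    | Sum.inr _, Sum.inl u => u = p ∨ u = q
    | Sum.inr _, Sum.inr _ => False)

namespace SimpleGraph

variable {V W : Type}

/-- A map sending adjacent vertices to reachable vertices preserves reachability. -/
lemma Reachable.map_of_forall_adj {A : SimpleGraph V} {B : SimpleGraph W} (f : V → W)
    (h : ∀ x y, A.Adj x y → B.Reachable (f x) (f y)) {u v : V} (huv : A.Reachable u v) :
    B.Reachable (f u) (f v) := by
  obtain ⟨c⟩ := huv
  induction c with
  | nil => rfl
  | cons hadj _ ih => exact (h _ _ hadj).trans ih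

lemma Connected.reachable_deleteEdges_or {H : SimpleGraph V} (hH : H.Connected) (x y z : V) :
    (H.deleteEdges {s(x, y)}).Reachable z x ∨ (H.deleteEdges {s(x, y)}).Reachable z y := by
  obtain ⟨c⟩ := hH z x
  induction c with
  | nil => exact .inl .rfl
  | @cons a b x hadj _ ih =>
    by_cases hab : s(a, b) = s(x, y)
    · rcases Sym2.eq_iff.1 hab with ⟨rfl, -⟩ | ⟨rfl, -⟩
      · exact .inl .rfl
      · exact .inr .rfl
    · have hr : (H.deleteEdges {s(x, y)}).Reachable a b :=
        Adj.reachable (deleteEdges_adj.2 ⟨hadj, hab⟩)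
      exact ih.imp hr.trans hr.trans

/-- Exchanging an edge of a tree for one joining the two components left by its removal
yields a tree. -/
lemma IsTree.deleteEdges_sup_edge {H : SimpleGraph V} (hH : H.IsTree) {f : Sym2 V} {u v : V}
    (huv : ¬ (H.deleteEdges {f}).Reachable u v) :
    (H.deleteEdges {f} ⊔ edge u v).IsTree := by
  have hne : u ≠ v := fun h => huv (h ▸ .rfl)
  refine ⟨?_, (hH.isAcyclic.anti (deleteEdges_le _)).sup_edge_of_not_reachable huv⟩
  induction f with | _ x y
  have hle : H.deleteEdges {s(x, y)} ≤ H.deleteEdges {s(x, y)} ⊔ edge u v := le_sup_left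
  have he : (H.deleteEdges {s(x, y)} ⊔ edge u v).Reachable u v :=
    Adj.reachable (.inr (by simp [edge_adj, hne]))
  have hxy : (H.deleteEdges {s(x, y)} ⊔ edge u v).Reachable x y := by
    rcases hH.connected.reachable_deleteEdges_or x y u with hu | hu <;>
      rcases hH.connected.reachable_deleteEdges_or x y v with hv | hv
    · exact (huv (hu.trans hv.symm)).elim
    · exact (hu.mono hle).symm.trans (he.trans (hv.mono hle))
    · exact (hv.mono hle).symm.trans (he.symm.trans (hu.mono hle))
    · exact (huv (hu.trans hv.symm)).elim
  have := hH.connected.nonempty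
  refine ⟨fun a b => (hH.connected a b).map_of_forall_adj id fun c d hcd => ?_⟩
  by_cases h : s(c, d) = s(x, y)
  · rcases Sym2.eq_iff.1 h with ⟨rfl, rfl⟩ | ⟨rfl, rfl⟩
    · exact hxy
    · exact hxy.symm
  · exact Adj.reachable (hle (deleteEdges_adj.2 ⟨hcd, h⟩))

/-- The spanning subgraph formed by the edges of weight less than `t`. -/
def below (G : SimpleGraph V) (w : Sym2 V → ℝ) (t : ℝ) : SimpleGraph V :=
  G.deleteEdges {e | t ≤ w e}

lemma below_adj {G : SimpleGraph V} {w : Sym2 V → ℝ} {t : ℝ} {u v : V} :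
    (G.below w t).Adj u v ↔ G.Adj u v ∧ w s(u, v) < t := by
  simp [below]

/-- The edges whose endpoints are not joined by a walk of strictly lighter edges. -/
def lightEdges (G : SimpleGraph V) (w : Sym2 V → ℝ) : Set (Sym2 V) :=
  {e | ∃ u v, e = s(u, v) ∧ G.Adj u v ∧ ¬ (G.below w (w s(u, v))).Reachable u v}

lemma mk_mem_lightEdges {G : SimpleGraph V} {w : Sym2 V → ℝ} {u v : V} :
    s(u, v) ∈ G.lightEdges w ↔ G.Adj u v ∧ ¬ (G.below w (w s(u, v))).Reachable u v := by
  refine ⟨?_, fun h => ⟨u, v, rfl, h⟩⟩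
  rintro ⟨a, b, hab, h⟩
  rcases Sym2.eq_iff.1 hab with ⟨rfl, rfl⟩ | ⟨rfl, rfl⟩
  · exact h
  · rw [Sym2.eq_swap, reachable_comm]
    exact ⟨h.1.symm, h.2⟩

end SimpleGraph

open SimpleGraph

lemma IsMST.isTree_spanningCoe {V : Type} {G : SimpleGraph V} {w : Sym2 V → ℝ} {T : G.Subgraph}
    (hT : IsMST G w T) : T.spanningCoe.IsTree :=
  (T.spanningCoeEquivCoeOfSpanning hT.1).isTree_iff.2 hT.2.1

lemma IsMST.weight_le {V : Type} [Finite V] {G : SimpleGraph V} {w : Sym2 V → ℝ} {T : G.Subgraph}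
    (hT : IsMST G w T) {f : Sym2 V} (hf : f ∈ T.edgeSet) {u v : V} (huv : G.Adj u v)
    (hr : ¬ (T.spanningCoe.deleteEdges {f}).Reachable u v) : w f ≤ w s(u, v) := by
  have hK := hT.isTree_spanningCoe.deleteEdges_sup_edge hr
  set K := T.spanningCoe.deleteEdges {f} ⊔ edge u v with hKdef
  have hKG : K ≤ G := by
    refine sup_le ((deleteEdges_le _).trans T.spanningCoe_le) ?_
    rw [edge_le_iff]
    exact .inr huv
  have hmin := hT.2.2 (toSubgraph K hKG) (toSubgraph.isSpanning K hKG)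
    (((toSubgraph K hKG).spanningCoeEquivCoeOfSpanning
      (toSubgraph.isSpanning K hKG)).isTree_iff.1 hK)
  have hedge : (toSubgraph K hKG).edgeSet = insert s(u, v) (T.edgeSet \ {f}) := by
    change K.edgeSet = _
    rw [hKdef, edgeSet_sup, edgeSet_deleteEdges, Subgraph.edgeSet_spanningCoe,
      edgeSet_edge_of_ne huv.ne, Set.union_comm, Set.insert_eq]
  have hnot : s(u, v) ∉ T.edgeSet \ {f} := fun h =>
    hr (Adj.reachable (deleteEdges_adj.2 h))
  have hsplit : ∑ᶠ e ∈ T.edgeSet, w e = w f + ∑ᶠ e ∈ T.edgeSet \ {f}, w e := by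
    rw [← finsum_mem_insert w (by simp) (Set.toFinite _), Set.insert_sdiff_singleton,
      Set.insert_eq_of_mem hf]
  rw [hedge, finsum_mem_insert w hnot (Set.toFinite _), hsplit] at hmin
  linarith

/-- With distinct weights, the minimum spanning tree consists of the light edges. -/
lemma IsMST.edgeSet_eq {V : Type} [Finite V] {G : SimpleGraph V} {w : Sym2 V → ℝ}
    {T : G.Subgraph} (hT : IsMST G w T) (hw : Set.InjOn w G.edgeSet) :
    T.edgeSet = G.lightEdges w := by
  ext e
  induction e with | _ u v
  rw [mk_mem_lightEdges]
  constructor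
  · intro he
    refine ⟨T.adj_sub he, fun hr => ?_⟩
    have hbr : ¬ (T.spanningCoe.deleteEdges {s(u, v)}).Reachable u v :=
      isBridge_iff.1 (isAcyclic_iff_forall_adj_isBridge.1 hT.isTree_spanningCoe.isAcyclic he)
    refine hbr (hr.map_of_forall_adj id fun x y hxy => ?_)
    rw [below_adj] at hxy
    by_contra hxr
    exact (hT.weight_le he hxy.1 hxr).not_gt hxy.2
  · rintro ⟨huv, hr⟩
    obtain ⟨P, hP, hPu⟩ := hT.isTree_spanningCoe.existsUnique_path u v
    obtain ⟨f, hfP, hf⟩ : ∃ f ∈ P.edges, w s(u, v) ≤ w f := by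
      by_contra! h
      refine hr ⟨P.transfer _ fun f hf => ?_⟩
      have hfG : f ∈ G.edgeSet :=
        T.edgeSet_subset (T.edgeSet_spanningCoe ▸ P.edges_subset_edgeSet hf)
      simpa [below, hfG] using h f hf
    have hfT : f ∈ T.edgeSet := T.edgeSet_spanningCoe ▸ P.edges_subset_edgeSet hfP
    have hfr : ¬ (T.spanningCoe.deleteEdges {f}).Reachable u v := by
      intro h
      obtain ⟨Q, hQ⟩ := h.exists_isPath
      have := hPu _ (hQ.mapLe (deleteEdges_le _))
      rw [← this, Walk.edges_mapLe_eq_edges] at hfP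
      have := Q.edges_subset_edgeSet hfP
      rw [edgeSet_deleteEdges] at this
      exact this.2 rfl
    have := hw (T.edgeSet_subset hfT) huv ((hT.weight_le hfT huv hfr).antisymm hf)
    exact this ▸ hfT

section addApex

variable {V : Type} {G : SimpleGraph V} {p q : V}

@[simp]
lemma addApex_adj_inl_inl {u v : V} :
    (addApex G p q).Adj (.inl u) (.inl v) ↔ G.Adj u v := by
  simp only [addApex, fromRel_adj, G.adj_comm v u, or_self, ne_eq, Sum.inl.injEq]
  exact ⟨And.right, fun h => ⟨h.ne, h⟩⟩

@[simp]
lemma addApex_adj_inl_inr {u : V} :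
    (addApex G p q).Adj (.inl u) (.inr ()) ↔ u = p ∨ u = q := by
  simp [addApex]

@[simp]
lemma addApex_adj_inr_inl {u : V} :
    (addApex G p q).Adj (.inr ()) (.inl u) ↔ u = p ∨ u = q := by
  simp [addApex]

lemma addApex_comm : addApex G p q = addApex G q p := by
  ext (x | ⟨⟨⟩⟩) (y | ⟨⟨⟩⟩) <;> simp [or_comm]

variable {w : Sym2 (V ⊕ Unit) → ℝ}

lemma not_reachable_below_addApex
    (hlt : w s(.inl p, .inr ()) < w s(.inl q, .inr ())) :
    ¬ ((addApex G p q).below w (w s(.inl p, .inr ()))).Reachable (.inl p) (.inr ()) := by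
  intro h
  have := h.map_of_forall_adj (B := (⊥ : SimpleGraph Bool)) Sum.isLeft ?_
  · simp at this
  rintro (x | x) (y | y) hxy <;> rw [below_adj] at hxy
  · rfl
  · rw [addApex_adj_inl_inr] at hxy
    obtain ⟨rfl | rfl, h⟩ := hxy <;> linarith
  · rw [addApex_adj_inr_inl, Sym2.eq_swap] at hxy
    obtain ⟨rfl | rfl, h⟩ := hxy <;> linarith

variable [DecidableEq V] {w' : Sym2 V → ℝ}

lemma reachable_below_addApex_iff (hpq : G.Adj p q)
    (hlt : w s(.inl p, .inr ()) < w s(.inl q, .inr ()))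
    (hw' : ∀ e : Sym2 V, w' e = if e = s(p, q) then
      min (w s(.inl p, .inl q)) (w s(.inl q, .inr ())) else w (e.map Sum.inl))
    {t : ℝ} {u v : V} :
    ((addApex G p q).below w t).Reachable (.inl u) (.inl v) ↔ (G.below w' t).Reachable u v := by
  have hpqt : w s(.inl q, .inr ()) < t → (G.below w' t).Reachable p q := fun h =>
    Adj.reachable (below_adj.2 ⟨hpq, by simp [hw', h]⟩)
  constructor
  · refine Reachable.map_of_forall_adj (Sum.elim id fun _ => p) ?_
    rintro (x | x) (y | y) hxy <;> rw [below_adj] at hxy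
    · rw [addApex_adj_inl_inl] at hxy
      refine Adj.reachable (below_adj.2 ⟨hxy.1, ?_⟩)
      rw [hw']
      split_ifs with h
      · have : s(Sum.inl x, Sum.inl y) = (s(Sum.inl p, Sum.inl q) : Sym2 (V ⊕ Unit)) :=
          congrArg (Sym2.map Sum.inl) h
        exact min_lt_of_left_lt (this ▸ hxy.2)
      · exact hxy.2
    · rw [addApex_adj_inl_inr] at hxy
      obtain ⟨rfl | rfl, h⟩ := hxy
      · rfl
      · exact (hpqt h).symm
    · rw [addApex_adj_inr_inl, Sym2.eq_swap] at hxy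
      obtain ⟨rfl | rfl, h⟩ := hxy
      · rfl
      · exact hpqt h
  · refine Reachable.map_of_forall_adj Sum.inl fun x y hxy => ?_
    rw [below_adj, hw'] at hxy
    have key : min (w s(.inl p, .inl q)) (w s(.inl q, .inr ())) < t →
        ((addApex G p q).below w t).Reachable (.inl p) (.inl q) := fun h => by
      rcases min_lt_iff.1 h with h | h
      · exact Adj.reachable (below_adj.2 ⟨by simpa using hpq, h⟩)
      · have h₁ : ((addApex G p q).below w t).Adj (.inl p) (.inr ()) :=
          below_adj.2 ⟨by simp, hlt.trans h⟩
        have h₂ : ((addApex G p q).below w t).Adj (.inl q) (.inr ()) :=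
          below_adj.2 ⟨by simp, h⟩
        exact h₁.reachable.trans h₂.reachable.symm
    split_ifs at hxy with h
    · rcases Sym2.eq_iff.1 h with ⟨rfl, rfl⟩ | ⟨rfl, rfl⟩
      · exact key hxy.2
      · exact (key hxy.2).symm
    · exact Adj.reachable (below_adj.2 ⟨by simpa using hxy.1, hxy.2⟩)

lemma image_lightEdges_addApex (hpq : G.Adj p q) (hdist : Set.InjOn w (addApex G p q).edgeSet)
    (hlt : w s(.inl p, .inr ()) < w s(.inl q, .inr ()))
    (hw' : ∀ e : Sym2 V, w' e = if e = s(p, q) then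
      min (w s(.inl p, .inl q)) (w s(.inl q, .inr ())) else w (e.map Sum.inl)) :
    w '' (addApex G p q).lightEdges w = w' '' G.lightEdges w' ∪ {w s(.inl p, .inr ())} := by
  have hreach := fun t u v => reachable_below_addApex_iff (t := t) (u := u) (v := v) hpq hlt hw'
  have hne : w s(.inl p, .inl q) ≠ w s(.inl q, .inr ()) := fun h => by
    simpa using hdist (by simpa using hpq) (by simp) h
  have hpr : ∀ {t}, w s(.inl p, .inr ()) < t →
      ((addApex G p q).below w t).Reachable (.inl p) (.inr ()) := fun h =>
    Adj.reachable (below_adj.2 ⟨by simp, h⟩)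
  have hqr : ((addApex G p q).below w (w s(.inl q, .inr ()))).Reachable (.inl q) (.inr ()) ↔
      (G.below w' (w s(.inl q, .inr ()))).Reachable p q := by
    rw [← hreach]
    exact ⟨fun h => (hpr hlt).trans h.symm, fun h => h.symm.trans (hpr hlt)⟩
  have hwpq : w' s(p, q) = min (w s(.inl p, .inl q)) (w s(.inl q, .inr ())) := by simp [hw']
  have hmem : s(.inl p, .inl q) ∈ (addApex G p q).lightEdges w ↔
      w s(.inl p, .inl q) < w s(.inl q, .inr ()) ∧ s(p, q) ∈ G.lightEdges w' := by
    rw [mk_mem_lightEdges, mk_mem_lightEdges, addApex_adj_inl_inl, hreach, hwpq]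
    rcases hne.lt_or_gt with h | h
    · simp [h, h.le]
    · have : (G.below w' (w s(.inl p, .inl q))).Adj p q :=
        below_adj.2 ⟨hpq, by simp [hwpq, h]⟩
      simp [h.not_gt, this.reachable]
  have hmemr : s(.inl q, .inr ()) ∈ (addApex G p q).lightEdges w ↔
      w s(.inl q, .inr ()) < w s(.inl p, .inl q) ∧ s(p, q) ∈ G.lightEdges w' := by
    rw [mk_mem_lightEdges, mk_mem_lightEdges, hqr, hwpq]
    rcases hne.lt_or_gt with h | h
    · have : (G.below w' (w s(.inl q, .inr ()))).Adj p q :=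
        below_adj.2 ⟨hpq, by simp [hwpq, h]⟩
      simp [h.not_gt, this.reachable]
    · simp [h, h.le, hpq]
  have hmemo : ∀ u v, s(u, v) ≠ s(p, q) →
      (s(.inl u, .inl v) ∈ (addApex G p q).lightEdges w ↔ s(u, v) ∈ G.lightEdges w') := by
    intro u v h
    rw [mk_mem_lightEdges, mk_mem_lightEdges, addApex_adj_inl_inl, hreach, hw', if_neg h]
    rfl
  have hapex : ∀ u, s(.inl u, .inr ()) ∈ (addApex G p q).lightEdges w →
      w s(.inl u, .inr ()) ∈ w' '' G.lightEdges w' ∪ {w s(.inl p, .inr ())} := by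
    intro u hu
    rcases addApex_adj_inl_inr.1 (mk_mem_lightEdges.1 hu).1 with rfl | rfl
    · exact .inr rfl
    · obtain ⟨h, he⟩ := hmemr.1 hu
      exact .inl ⟨_, he, by rw [hwpq, min_eq_right h.le]⟩
  ext t
  constructor
  · rintro ⟨e, he, rfl⟩
    induction e with | _ x y
    rcases x with u | ⟨⟨⟩⟩ <;> rcases y with v | ⟨⟨⟩⟩
    · by_cases huv : s(u, v) = s(p, q)
      · have : s(Sum.inl u, Sum.inl v) = (s(Sum.inl p, Sum.inl q) : Sym2 (V ⊕ Unit)) :=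
          congrArg (Sym2.map Sum.inl) huv
        rw [this] at he ⊢
        obtain ⟨h, he⟩ := hmem.1 he
        exact .inl ⟨_, he, by rw [hwpq, min_eq_left h.le]⟩
      · exact .inl ⟨_, (hmemo u v huv).1 he, by rw [hw', if_neg huv]; rfl⟩
    · exact hapex u he
    · rw [Sym2.eq_swap (a := Sum.inr ()) (b := Sum.inl v)] at he ⊢
      exact hapex v he
    · exact ((mk_mem_lightEdges.1 he).1.ne rfl).elim
  · rintro (⟨e, he, rfl⟩ | rfl)
    · induction e with | _ u v
      by_cases huv : s(u, v) = s(p, q)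
      · rw [huv] at he ⊢
        rcases hne.lt_or_gt with h | h
        · exact ⟨_, hmem.2 ⟨h, he⟩, by rw [hwpq, min_eq_left h.le]⟩
        · exact ⟨_, hmemr.2 ⟨h, he⟩, by rw [hwpq, min_eq_right h.le]⟩
      · exact ⟨_, (hmemo u v huv).2 he, by rw [hw', if_neg huv]; rfl⟩
    · exact ⟨_, mk_mem_lightEdges.2 ⟨by simp, not_reachable_below_addApex hlt⟩, rfl⟩

lemma injOn_reweight (hpq : G.Adj p q) (hdist : Set.InjOn w (addApex G p q).edgeSet)
    (hw' : ∀ e : Sym2 V, w' e = if e = s(p, q) then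
      min (w s(.inl p, .inl q)) (max (w s(.inl p, .inr ())) (w s(.inl q, .inr ())))
      else w (e.map Sum.inl)) :
    Set.InjOn w' G.edgeSet := by
  obtain ⟨b, hb, hbw, hbpq⟩ : ∃ b ∈ (addApex G p q).edgeSet,
      min (w s(.inl p, .inl q)) (max (w s(.inl p, .inr ())) (w s(.inl q, .inr ()))) = w b ∧
      ∀ e : Sym2 V, e.map Sum.inl = b → e = s(p, q) := by
    rcases min_choice (w s(.inl p, .inl q))
      (max (w s(.inl p, .inr ())) (w s(.inl q, .inr ()))) with h | h
    · exact ⟨_, by simpa using hpq, h, fun e he =>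
        Sym2.map.injective Sum.inl_injective (he.trans (Sym2.map_mk ..).symm)⟩
    · have hno : ∀ (x : V) (e : Sym2 V), e.map Sum.inl ≠ s(.inl x, .inr ()) := by
        intro x e
        induction e with | _ u v
        simp
      rcases max_choice (w s(.inl p, .inr ())) (w s(.inl q, .inr ())) with h' | h'
      · exact ⟨_, by simp, h.trans h', fun e he => (hno _ _ he).elim⟩
      · exact ⟨_, by simp, h.trans h', fun e he => (hno _ _ he).elim⟩
  have hmap : ∀ e ∈ G.edgeSet, e.map Sum.inl ∈ (addApex G p q).edgeSet := by
    intro e he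
    induction e with | _ u v
    simpa using he
  intro e he f hf hef
  rw [hw', hw', hbw] at hef
  split_ifs at hef with h₁ h₂ h₂
  · rw [h₁, h₂]
  · exact (h₂ (hbpq f (hdist hb (hmap f hf) hef).symm)).elim
  · exact (h₁ (hbpq e (hdist (hmap e he) hb hef))).elim
  · exact Sym2.map.injective Sum.inl_injective (hdist (hmap e he) (hmap f hf) hef)

end addApex

/-- Replacing edge `pq` by a triangle `pqr`: the MST edge weights of `G⁺` are those of
the reweighted `G` (where `pq` gets the bottleneck weight of the triangle), together with
the minimum weight among the two non-bottleneck edges of the triangle. -/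
theorem mst_addApex (V : Type) [Fintype V] [DecidableEq V] (G : SimpleGraph V) (hG : G.Connected)
    (p q : V) (hpq : G.Adj p q)
    (w : Sym2 (V ⊕ Unit) → ℝ)
    (hdist : Set.InjOn w (addApex G p q).edgeSet)
    -- the bottleneck weight of the triangle pqr between p and q
    (bw : ℝ)
    (hbw : bw = min (w s(Sum.inl p, Sum.inl q))
        (max (w s(Sum.inl p, Sum.inr ())) (w s(Sum.inl q, Sum.inr ()))))
    -- the minimum weight among the two non-bottleneck edges of the triangle
    (mnb : ℝ)
    (hmnb : mnb = min (w s(Sum.inl p, Sum.inr ())) (w s(Sum.inl q, Sum.inr ())))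
    -- the reweighting of G: edge pq gets the bottleneck weight, other edges keep theirs
    (w' : Sym2 V → ℝ)
    (hw' : ∀ e : Sym2 V, w' e = if e = s(p, q) then bw else w (e.map Sum.inl))
    (Tplus : (addApex G p q).Subgraph) (T : G.Subgraph)
    (hTplus : IsMST (addApex G p q) w Tplus) (hT : IsMST G w' T) :
    w '' Tplus.edgeSet = w' '' T.edgeSet ∪ {mnb} := by
  subst hbw hmnb
  rw [hTplus.edgeSet_eq hdist, hT.edgeSet_eq (injOn_reweight hpq hdist hw')]
  have hne : w s(.inl p, .inr ()) ≠ w s(.inl q, .inr ()) := fun h => by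
    simpa [hpq.ne] using hdist (by simp) (by simp) h
  rcases hne.lt_or_gt with h | h
  · rw [max_eq_right h.le] at hw'
    rw [min_eq_left h.le]
    exact image_lightEdges_addApex hpq hdist h hw'
  · rw [max_eq_left h.le, Sym2.eq_swap (a := Sum.inl p) (b := Sum.inl q),
      Sym2.eq_swap (a := p) (b := q)] at hw'
    rw [addApex_comm] at hdist ⊢
    rw [min_eq_right h.le]
    exact image_lightEdges_addApex hpq.symm hdist h hw'
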